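/- There is a constant C > 1, depending only on Q, such that every null-homotopic word w over Q satisfies Area(w) ≤ C^{ℓ(w)}: in the free group on {a,b,r,s,t}, w is equal to a product of at most C^{ℓ(w)} conjugates of elements of R ∪ R⁻¹, where R is the set of relators of Q. -/

import Mathlib

/-! Words over an alphabet `A`: a letter `(x, true)` is the generator `x`,
and `(x, false)` is its formal inverse `x⁻¹`. -/

/-- A word over the alphabet `A ∪ A⁻¹`. -/
abbrev Word (A : Type*) := List (A × Bool)

namespace Word

/-- The formal inverse of a word. -/
def inv {A : Type*} (w : Word A) : Word A := (w.map fun p => (p.1, !p.2)).reverse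

/-- `w'` is a cyclic conjugate (cyclic permutation) of `w`. -/
def IsCyclicConj {A : Type*} (w w' : Word A) : Prop :=
  ∃ u v : Word A, w = u ++ v ∧ w' = v ++ u

end Word

/-- Moves (i)–(iii) on words with respect to a set `R` of relator words:
free reduction, free expansion, and application of a relator (replace a subword `u`
by `v` where some cyclic conjugate of `u * v⁻¹` lies in `R ∪ R⁻¹`). -/
inductive Move {A : Type*} (R : Set (Word A)) : Word A → Word A → Prop
  | freeReduce (u v : Word A) (x : A) (b : Bool) :
      Move R (u ++ (x, b) :: (x, !b) :: v) (u ++ v)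
  | freeExpand (u v : Word A) (x : A) (b : Bool) :
      Move R (u ++ v) (u ++ (x, b) :: (x, !b) :: v)
  | relator (p q u v z : Word A)
      (hz : Word.IsCyclicConj (u ++ Word.inv v) z) (hR : z ∈ R ∨ Word.inv z ∈ R) :
      Move R (p ++ u ++ q) (p ++ v ++ q)

/-- Moves (i)–(iv): moves (i)–(iii) together with cyclic conjugation. -/
inductive MoveC {A : Type*} (R : Set (Word A)) : Word A → Word A → Prop
  | of {w w' : Word A} : Move R w w' → MoveC R w w'
  | cyc {w w' : Word A} : Word.IsCyclicConj w w' → MoveC R w w'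

/-- Moves (i)–(v) on finite sequences of words: one of the moves (i)–(iv) applied to
one word of the sequence, or fragmentation of one word `u ++ v` into `u` and `v`. -/
inductive MoveF {A : Type*} (R : Set (Word A)) : List (Word A) → List (Word A) → Prop
  | of (l₁ l₂ : List (Word A)) {w w' : Word A} :
      MoveC R w w' → MoveF R (l₁ ++ w :: l₂) (l₁ ++ w' :: l₂)
  | frag (l₁ l₂ : List (Word A)) (u v : Word A) :
      MoveF R (l₁ ++ (u ++ v) :: l₂) (l₁ ++ u :: v :: l₂)

/-- A word is null-homotopic over the presentation with relator set `R` if it represents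
the identity of the presented group, i.e. lies in the normal closure of the relators. -/
def NullHomotopic {A : Type*} (R : Set (Word A)) (w : Word A) : Prop :=
  FreeGroup.mk w ∈ Subgroup.normalClosure (FreeGroup.mk '' R)

/-- `FLle R w L`: the word `w` can be converted to the empty word by moves (i)–(iii)
with every intermediate word of length at most `L`. -/
def FLle {A : Type*} (R : Set (Word A)) (w : Word A) (L : ℕ) : Prop :=
  ∃ (m : ℕ) (f : ℕ → Word A), f 0 = w ∧ f m = [] ∧
    (∀ i < m, Move R (f i) (f (i + 1))) ∧ ∀ i ≤ m, (f i).length ≤ L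

/-- `FFLle R w L`: the word `w` can be converted to the empty word by moves (i)–(iv)
with every intermediate word of length at most `L`. -/
def FFLle {A : Type*} (R : Set (Word A)) (w : Word A) (L : ℕ) : Prop :=
  ∃ (m : ℕ) (f : ℕ → Word A), f 0 = w ∧ f m = [] ∧
    (∀ i < m, MoveC R (f i) (f (i + 1))) ∧ ∀ i ≤ m, (f i).length ≤ L

/-- The total length of a finite sequence of words. -/
def totalLength {A : Type*} (l : List (Word A)) : ℕ := (l.map List.length).sum

/-- `FFFLle R w L`: the length-one sequence `(w)` can be converted to a sequence of empty
words by moves (i)–(v) with every intermediate sequence of total length at most `L`. -/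
def FFFLle {A : Type*} (R : Set (Word A)) (w : Word A) (L : ℕ) : Prop :=
  ∃ (m : ℕ) (f : ℕ → List (Word A)), f 0 = [w] ∧ (∀ u ∈ f m, u = ([] : Word A)) ∧
    (∀ i < m, MoveF R (f i) (f (i + 1))) ∧ ∀ i ≤ m, totalLength (f i) ≤ L

/-- An element `x` of the free group is a conjugate of a relator of `R` or of an inverse
of a relator. -/
def IsConjRelator {A : Type*} (R : Set (Word A)) (x : FreeGroup A) : Prop :=
  ∃ c ρ : FreeGroup A, (ρ ∈ FreeGroup.mk '' R ∨ ρ⁻¹ ∈ FreeGroup.mk '' R) ∧ x = c * ρ * c⁻¹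

/-- `AreaLe R g N`: in the free group, `g` is a product of at most `N` conjugates
of elements of `R ∪ R⁻¹`. -/
def AreaLe {A : Type*} (R : Set (Word A)) (g : FreeGroup A) (N : ℕ) : Prop :=
  ∃ l : List (FreeGroup A), l.length ≤ N ∧ (∀ x ∈ l, IsConjRelator R x) ∧ l.prod = g

/-- The number of occurrences in `w` of the letter `x` or its inverse. -/
def countLtr {A : Type*} [DecidableEq A] (x : A) (w : Word A) : ℕ :=
  (w.filter fun p => p.1 = x).length

/-- The filling length `FL(w)` of a null-homotopic word. -/
noncomputable def FLw {A : Type*} (R : Set (Word A)) (w : Word A) : ℕ :=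
  sInf {L | FLle R w L}

/-- The free filling length `FFL(w)` of a null-homotopic word. -/
noncomputable def FFLw {A : Type*} (R : Set (Word A)) (w : Word A) : ℕ :=
  sInf {L | FFLle R w L}

/-- The fragmenting free filling length `FFFL(w)` of a null-homotopic word. -/
noncomputable def FFFLw {A : Type*} (R : Set (Word A)) (w : Word A) : ℕ :=
  sInf {L | FFFLle R w L}

/-- The filling length function `FL : ℕ → ℕ` of the presentation with relators `R`. -/
noncomputable def FLfn {A : Type*} (R : Set (Word A)) (n : ℕ) : ℕ :=
  sSup (FLw R '' {w | NullHomotopic R w ∧ w.length ≤ n})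

/-- The free filling length function `FFL : ℕ → ℕ`. -/
noncomputable def FFLfn {A : Type*} (R : Set (Word A)) (n : ℕ) : ℕ :=
  sSup (FFLw R '' {w | NullHomotopic R w ∧ w.length ≤ n})

/-- The fragmenting free filling length function `FFFL : ℕ → ℕ`. -/
noncomputable def FFFLfn {A : Type*} (R : Set (Word A)) (n : ℕ) : ℕ :=
  sSup (FFFLw R '' {w | NullHomotopic R w ∧ w.length ≤ n})

/-! The presentation `Q = ⟨a, b, r, s, t | a^b a⁻², [t,a], [r,at], [r,s], [s,t]⟩`. -/

/-- The five generators of the presentation `Q`. -/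
inductive QGen | a | b | r | s | t
deriving DecidableEq

/-- The five relators of `Q`: `b⁻¹aba⁻¹a⁻¹`, `t⁻¹a⁻¹ta`, `r⁻¹t⁻¹a⁻¹rat`,
`r⁻¹s⁻¹rs`, `s⁻¹t⁻¹st`. -/
def QRels : Set (Word QGen) :=
  { [(QGen.b, false), (QGen.a, true), (QGen.b, true), (QGen.a, false), (QGen.a, false)],
    [(QGen.t, false), (QGen.a, false), (QGen.t, true), (QGen.a, true)],
    [(QGen.r, false), (QGen.t, false), (QGen.a, false), (QGen.r, true), (QGen.a, true),
      (QGen.t, true)],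
    [(QGen.r, false), (QGen.s, false), (QGen.r, true), (QGen.s, true)],
    [(QGen.s, false), (QGen.t, false), (QGen.s, true), (QGen.t, true)] }

/-- The word `bⁿ`. -/
def bpow (n : ℕ) : Word QGen := List.replicate n (QGen.b, true)

/-- The word `b⁻ⁿ`. -/
def bpowInv (n : ℕ) : Word QGen := List.replicate n (QGen.b, false)

/-- The word `a^{-bⁿ} = b⁻ⁿ a⁻¹ bⁿ`. -/
def aConjNeg (n : ℕ) : Word QGen := bpowInv n ++ [(QGen.a, false)] ++ bpow n

/-- The word `a^{bⁿ} = b⁻ⁿ a bⁿ`. -/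
def aConjPos (n : ℕ) : Word QGen := bpowInv n ++ [(QGen.a, true)] ++ bpow n

/-- The word `a^{-bⁿ} r a^{bⁿ}`. -/
def gword (n : ℕ) : Word QGen := aConjNeg n ++ [(QGen.r, true)] ++ aConjPos n

/-- The word `w_n = [s, a^{-bⁿ} r a^{bⁿ}] = s⁻¹ (b⁻ⁿa⁻¹bⁿ r b⁻ⁿabⁿ)⁻¹ s (b⁻ⁿa⁻¹bⁿ r b⁻ⁿabⁿ)`. -/
def wn (n : ℕ) : Word QGen :=
  [(QGen.s, false)] ++ Word.inv (gword n) ++ [(QGen.s, true)] ++ gword n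

/-- The word `a^{-bⁿ} r a^{bⁿ} r a^{bⁿ} r⁻¹ a^{-bⁿ}`. -/
def g'word (n : ℕ) : Word QGen :=
  aConjNeg n ++ [(QGen.r, true)] ++ aConjPos n ++ [(QGen.r, true)] ++ aConjPos n ++
    [(QGen.r, false)] ++ aConjNeg n

/-- The word `w'_n = [s, a^{-bⁿ} r a^{bⁿ} r a^{bⁿ} r⁻¹ a^{-bⁿ}]`. -/
def w'n (n : ℕ) : Word QGen :=
  [(QGen.s, false)] ++ Word.inv (g'word n) ++ [(QGen.s, true)] ++ g'word n

/-! ### Equality up to boundedly many relators -/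

namespace AreaLe

variable {A : Type*} {R : Set (Word A)}

theorem one : AreaLe R 1 0 := ⟨[], by simp, by simp, by simp⟩

theorem mono {g : FreeGroup A} {m n : ℕ} (h : AreaLe R g m) (hmn : m ≤ n) : AreaLe R g n := by
  obtain ⟨l, hl, hc, hp⟩ := h
  exact ⟨l, hl.trans hmn, hc, hp⟩

theorem mul {g h : FreeGroup A} {m n : ℕ} (hg : AreaLe R g m) (hh : AreaLe R h n) :
    AreaLe R (g * h) (m + n) := by
  obtain ⟨l, hl, hc, rfl⟩ := hg
  obtain ⟨l', hl', hc', rfl⟩ := hh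
  refine ⟨l ++ l', by simp; omega, ?_, by simp⟩
  intro x hx
  rcases List.mem_append.1 hx with hx | hx
  exacts [hc x hx, hc' x hx]

theorem conj {g : FreeGroup A} {n : ℕ} (hg : AreaLe R g n) (k : FreeGroup A) :
    AreaLe R (k * g * k⁻¹) n := by
  obtain ⟨l, hl, hc, rfl⟩ := hg
  refine ⟨l.map (MulAut.conj k), by simpa using hl, ?_, by
    rw [← map_list_prod, MulAut.conj_apply]⟩
  intro x hx
  obtain ⟨y, hy, rfl⟩ := List.mem_map.1 hx
  obtain ⟨c, ρ, hρ, rfl⟩ := hc y hy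
  exact ⟨k * c, ρ, hρ, by simp only [MulAut.conj_apply]; group⟩

theorem inv {g : FreeGroup A} {n : ℕ} (hg : AreaLe R g n) : AreaLe R g⁻¹ n := by
  obtain ⟨l, hl, hc, rfl⟩ := hg
  refine ⟨(l.map (·⁻¹)).reverse, by simpa using hl, ?_, by rw [List.prod_inv_reverse]⟩
  intro x hx
  obtain ⟨y, hy, rfl⟩ := List.mem_map.1 (List.mem_reverse.1 hx)
  obtain ⟨c, ρ, hρ, rfl⟩ := hc y hy
  exact ⟨c, ρ⁻¹, by rw [inv_inv]; exact hρ.symm, by group⟩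

end AreaLe

/-- `Near R g h n`: the element `g` can be turned into `h` by applying at most `n` relators. -/
def Near {A : Type*} (R : Set (Word A)) (g h : FreeGroup A) (n : ℕ) : Prop :=
  AreaLe R (g * h⁻¹) n

namespace Near

variable {A : Type*} {R : Set (Word A)} {g h k g' h' : FreeGroup A} {m n : ℕ}

theorem refl (g : FreeGroup A) : Near R g g 0 := by
  simpa [Near] using AreaLe.one

theorem of_eq (e : g = h) : Near R g h 0 := e ▸ refl g

theorem mono (H : Near R g h m) (hmn : m ≤ n) : Near R g h n := AreaLe.mono H hmn

theorem of_relator (w : Word A) (hw : w ∈ R) (e : FreeGroup.mk w = h⁻¹ * g) : Near R g h 1 := by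
  refine ⟨[g * h⁻¹], by simp, ?_, by simp⟩
  intro x hx
  rw [List.mem_singleton.1 hx]
  exact ⟨h, h⁻¹ * g, Or.inl ⟨w, hw, e⟩, by group⟩

theorem symm (H : Near R g h n) : Near R h g n := by
  have := AreaLe.inv H
  simpa [Near] using this

theorem trans (H : Near R g h m) (H' : Near R h k n) : Near R g k (m + n) := by
  have := AreaLe.mul H H'
  simpa [Near, mul_assoc] using this

theorem mul_left (H : Near R g h n) (k : FreeGroup A) : Near R (k * g) (k * h) n := by
  have := AreaLe.conj H k
  simpa [Near, mul_assoc] using this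

theorem mul_right (H : Near R g h n) (k : FreeGroup A) : Near R (g * k) (h * k) n := by
  simpa [Near, mul_assoc] using H

theorem mul (H : Near R g h m) (H' : Near R g' h' n) : Near R (g * g') (h * h') (m + n) :=
  (H.mul_right g').trans (H'.mul_left h)

theorem inv (H : Near R g h n) : Near R g⁻¹ h⁻¹ n := by
  have := (H.mul_left g⁻¹).mul_right h⁻¹
  simpa [mul_assoc] using this.symm

theorem pow (H : Near R g h n) (m : ℕ) : Near R (g ^ m) (h ^ m) (m * n) := by
  induction m with
  | zero => simpa using refl 1
  | succ m ih => simpa [pow_succ, add_mul] using ih.mul H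

theorem zpow (H : Near R g h n) (m : ℤ) : Near R (g ^ m) (h ^ m) (m.natAbs * n) := by
  obtain ⟨k, rfl | rfl⟩ := m.eq_nat_or_neg
  · simpa using H.pow k
  · simpa using (H.pow k).inv

theorem comm_inv_left (H : Near R (g * h) (h * g) n) : Near R (g⁻¹ * h) (h * g⁻¹) n := by
  have := (H.mul_left g⁻¹).mul_right g⁻¹
  simpa [mul_assoc] using this.symm

theorem comm_inv_right (H : Near R (g * h) (h * g) n) : Near R (g * h⁻¹) (h⁻¹ * g) n :=
  (H.symm.comm_inv_left).symm

theorem comm_mul_right (H : Near R (g * h) (h * g) m) (H' : Near R (g * k) (k * g) n) :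
    Near R (g * (h * k)) (h * k * g) (m + n) := by
  have := (H.mul_right k).trans
    ((of_eq (mul_assoc h g k)).trans (H'.mul_left h))
  simpa [mul_assoc] using this

end Near

/-! ### The splitting of the presented group as an HNN extension of `F₂ × F₂` -/

namespace QGen

open FreeGroup (mk)

/-- A word is `b`-free if neither `b` nor its inverse occurs in it. -/
def BFree (w : Word QGen) : Prop := ∀ p ∈ w, p.1 ≠ b

/-- The vertex group `F(x, s) × F(t, r)`, where `x = at`. -/
abbrev Base : Type := FreeGroup Bool × FreeGroup Bool

/-- The images of the generators in the vertex group (`b` is killed). -/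
def toBaseGen : QGen → Base
  | a => (.of true, (.of true)⁻¹)
  | b => 1
  | r => (1, .of false)
  | s => (.of false, 1)
  | t => (1, .of true)

/-- The projection to the vertex group. -/
def toBase : FreeGroup QGen →* Base := FreeGroup.lift toBaseGen

/-- The lift of the first factor of the vertex group to the free group. -/
def liftFst : FreeGroup Bool →* FreeGroup QGen :=
  FreeGroup.lift fun e => if e then .of a * .of t else .of s

/-- The lift of the second factor of the vertex group to the free group. -/
def liftSnd : FreeGroup Bool →* FreeGroup QGen :=
  FreeGroup.lift fun e => if e then .of t else .of r

/-- The first component of an element of the free group, as an element of the free group. -/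
def fstPart : FreeGroup QGen →* FreeGroup QGen :=
  liftFst.comp ((MonoidHom.fst _ _).comp toBase)

/-- The second component of an element of the free group, as an element of the free group. -/
def sndPart : FreeGroup QGen →* FreeGroup QGen :=
  liftSnd.comp ((MonoidHom.snd _ _).comp toBase)

theorem mk_cons (p : QGen × Bool) (u : Word QGen) : mk (p :: u) = mk [p] * mk u := by
  simp [FreeGroup.mul_mk]

theorem mk_true (x : QGen) : mk [(x, true)] = .of x := rfl

theorem mk_false (x : QGen) : mk [(x, false)] = (.of x)⁻¹ := rfl

theorem near_t_a : Near QRels (.of t * .of a) (.of a * .of t) 1 :=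
  .of_relator [(t, false), (a, false), (t, true), (a, true)] (by simp [QRels]) rfl

theorem near_r_x : Near QRels (.of r * (.of a * .of t)) (.of a * .of t * .of r) 1 :=
  .of_relator [(r, false), (t, false), (a, false), (r, true), (a, true), (t, true)]
    (by simp [QRels]) rfl

theorem near_r_s : Near QRels (.of r * .of s) (.of s * .of r) 1 :=
  .of_relator [(r, false), (s, false), (r, true), (s, true)] (by simp [QRels]) rfl

theorem near_t_s : Near QRels (.of t * .of s) (.of s * .of t) 1 :=
  Near.symm <| .of_relator [(s, false), (t, false), (s, true), (t, true)] (by simp [QRels]) rfl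

theorem near_t_x : Near QRels (.of t * (.of a * .of t)) (.of a * .of t * .of t) 1 := by
  simpa [mul_assoc] using near_t_a.mul_right (.of t)

theorem near_conj_a :
    Near QRels ((.of b)⁻¹ * .of a * .of b) (.of a * .of a) 1 := by
  refine ⟨[(.of b)⁻¹ * .of a * .of b * (.of a * .of a)⁻¹], by simp, ?_, by simp⟩
  intro x hx
  rw [List.mem_singleton.1 hx]
  exact ⟨1, (.of b)⁻¹ * .of a * .of b * (.of a * .of a)⁻¹, Or.inl ⟨[(b, false), (a, true), (b, true), (a, false), (a, false)],
    by simp [QRels], rfl⟩, by simp⟩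

theorem near_comm_fstPart {y : FreeGroup QGen}
    (hx : Near QRels (y * (.of a * .of t)) (.of a * .of t * y) 1)
    (hs : Near QRels (y * .of s) (.of s * y) 1) (u : Word QGen) :
    Near QRels (y * fstPart (mk u)) (fstPart (mk u) * y) u.length := by
  induction u with
  | nil => exact Near.of_eq (by rw [← FreeGroup.one_eq_mk]; simp)
  | cons p u ih =>
    rw [mk_cons, map_mul, List.length_cons, add_comm]
    refine Near.comm_mul_right ?_ ih
    obtain ⟨x, e⟩ := p
    have h1 : Near QRels y y 1 := (Near.refl y).mono zero_le_one
    have key : Near QRels (y * fstPart (.of x)) (fstPart (.of x) * y) 1 := by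
      cases x <;> simpa [fstPart, toBase, toBaseGen, liftFst] using (by assumption)
    cases e
    · rw [mk_false, map_inv]; exact key.comm_inv_right
    · exact key

theorem near_comm_fstPart_t (u : Word QGen) :
    Near QRels (.of t * fstPart (mk u)) (fstPart (mk u) * .of t) u.length :=
  near_comm_fstPart near_t_x near_t_s u

theorem near_comm_fstPart_r (u : Word QGen) :
    Near QRels (.of r * fstPart (mk u)) (fstPart (mk u) * .of r) u.length :=
  near_comm_fstPart near_r_x near_r_s u

/-- Moving the second part of a letter past the first part of a word. -/
theorem near_comm_sndPart_letter (p : QGen × Bool) (u : Word QGen) :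
    Near QRels (sndPart (mk [p]) * fstPart (mk u)) (fstPart (mk u) * sndPart (mk [p]))
      u.length := by
  obtain ⟨x, e⟩ := p
  have h1 : Near QRels (fstPart (mk u)) (fstPart (mk u)) u.length :=
    (Near.refl _).mono (Nat.zero_le _)
  have ht := near_comm_fstPart_t u
  have hr := near_comm_fstPart_r u
  have ht' := ht.comm_inv_left
  have key : Near QRels (sndPart (.of x) * fstPart (mk u)) (fstPart (mk u) * sndPart (.of x))
      u.length := by
    generalize fstPart (mk u) = z at *
    cases x <;> simpa [sndPart, toBase, toBaseGen, liftSnd] using (by assumption)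
  cases e
  · rw [mk_false, map_inv]; exact key.comm_inv_left
  · exact key

theorem letter_eq_parts (p : QGen × Bool) (hp : p.1 ≠ b) :
    mk [p] = fstPart (mk [p]) * sndPart (mk [p]) ∨
      mk [p] = sndPart (mk [p]) * fstPart (mk [p]) := by
  obtain ⟨x, e⟩ := p
  have key : FreeGroup.of x = fstPart (.of x) * sndPart (.of x) := by
    cases x <;> simp_all [fstPart, sndPart, toBase, toBaseGen, liftFst, liftSnd]
  cases e
  · right; rw [mk_false, map_inv, map_inv, ← mul_inv_rev, ← key]
  · left; exact key

theorem near_parts_letter (p : QGen × Bool) (hp : p.1 ≠ b) :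
    Near QRels (mk [p]) (fstPart (mk [p]) * sndPart (mk [p])) 1 := by
  rcases letter_eq_parts p hp with h | h
  · exact (Near.of_eq h).mono zero_le_one
  · simpa using (Near.of_eq h).trans (near_comm_sndPart_letter p [p])

theorem near_parts (u : Word QGen) (hu : BFree u) :
    Near QRels (mk u) (fstPart (mk u) * sndPart (mk u)) (u.length ^ 2) := by
  induction u with
  | nil => exact Near.of_eq (by rw [← FreeGroup.one_eq_mk]; simp)
  | cons p u ih =>
    have h1 := near_parts_letter p (hu p (by simp))
    have h2 := ih fun q hq => hu q (by simp [hq])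
    have h3 := ((near_comm_sndPart_letter p u).mul_left (fstPart (mk [p]))).mul_right
      (sndPart (mk u))
    rw [mk_cons, map_mul, map_mul]
    have h4 := (h1.mul h2).trans ((Near.of_eq (by group)).trans (h3.trans (Near.of_eq
      (h := fstPart (mk [p]) * fstPart (mk u) * (sndPart (mk [p]) * sndPart (mk u)))
      (by group))))
    exact h4.mono (by rw [List.length_cons]; nlinarith)

theorem area_le_of_toBase_eq_one (u : Word QGen) (hu : BFree u) (h : toBase (mk u) = 1) :
    AreaLe QRels (mk u) (u.length ^ 2) := by
  simpa [Near, fstPart, sndPart, h] using near_parts u hu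

/-- The word `aᵐ`. -/
def aWord (m : ℤ) : Word QGen := List.replicate m.natAbs (a, decide (0 ≤ m))

theorem length_aWord (m : ℤ) : (aWord m).length = m.natAbs := by simp [aWord]

theorem bFree_aWord (m : ℤ) : BFree (aWord m) := by
  intro p hp
  rw [(List.mem_replicate.1 hp).2]
  simp

theorem mk_replicate (p : QGen × Bool) (n : ℕ) : mk (List.replicate n p) = mk [p] ^ n := by
  induction n with
  | zero => rfl
  | succ n ih => rw [List.replicate_succ, mk_cons, ih, pow_succ']

theorem mk_aWord (m : ℤ) : mk (aWord m) = .of a ^ m := by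
  rw [aWord, mk_replicate]
  rcases le_or_gt 0 m with h | h
  · lift m to ℕ using h
    simp [mk_true]
  · obtain ⟨k, rfl⟩ := Int.exists_eq_neg_ofNat h.le
    have : ¬ (0 : ℤ) ≤ -k := by omega
    rw [decide_eq_false this, Int.natAbs_neg, Int.natAbs_natCast, mk_false, inv_pow, zpow_neg,
      zpow_natCast]

/-- The image of `a` in the vertex group. -/
abbrev aBase : Base := toBaseGen a

theorem near_zpow_a (u : Word QGen) (hu : BFree u) (m : ℤ) (h : toBase (mk u) = aBase ^ m) :
    Near QRels (mk u) (.of a ^ m) ((u.length + m.natAbs) ^ 2) := by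
  have e : mk (u ++ aWord (-m)) = mk u * (.of a ^ m)⁻¹ := by
    rw [← FreeGroup.mul_mk, mk_aWord, zpow_neg]
  have := area_le_of_toBase_eq_one (u ++ aWord (-m)) (by
    intro p hp
    rcases List.mem_append.1 hp with hp | hp
    exacts [hu p hp, bFree_aWord _ p hp]) (by
    rw [e, map_mul, h, map_inv, map_zpow]; simp [toBase])
  rwa [e, List.length_append, length_aWord, Int.natAbs_neg] at this

/-- The exponent sum of `x` in the first factor. -/
def expSum : Base →* Multiplicative ℤ :=
  (FreeGroup.lift fun e => if e then .ofAdd 1 else 1).comp (MonoidHom.fst _ _)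

theorem expSum_aBase_zpow (m : ℤ) : (expSum (aBase ^ m)).toAdd = m := by
  simp [expSum, toBaseGen]

theorem natAbs_expSum_le (u : Word QGen) :
    (expSum (toBase (mk u))).toAdd.natAbs ≤ u.length := by
  induction u with
  | nil => rw [← FreeGroup.one_eq_mk]; simp
  | cons p u ih =>
    rw [mk_cons, map_mul, map_mul, toAdd_mul, List.length_cons]
    have key : (expSum (toBase (mk [p]))).toAdd.natAbs ≤ 1 := by
      obtain ⟨x, e⟩ := p
      cases e <;> cases x <;> simp [expSum, toBase, toBaseGen]
    omega

theorem natAbs_le_length {u : Word QGen} {m : ℤ} (h : toBase (mk u) = aBase ^ m) :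
    m.natAbs ≤ u.length := by
  have := natAbs_expSum_le u
  rwa [h, expSum_aBase_zpow] at this

theorem zpowersHom_aBase_injective : Function.Injective (zpowersHom Base aBase) := by
  intro m n h
  have := congrArg (fun g => (expSum g).toAdd) h
  simpa only [zpowersHom_apply, expSum_aBase_zpow, EmbeddingLike.apply_eq_iff_eq] using this

theorem zpowersHom_aBase_sq_injective : Function.Injective (zpowersHom Base (aBase ^ (2 : ℤ))) := by
  intro m n h
  have := congrArg (fun g => (expSum g).toAdd) h
  simp only [zpowersHom_apply, ← zpow_mul, expSum_aBase_zpow] at this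
  exact Multiplicative.toAdd.injective (by omega)

/-- The isomorphism `aᵐ ↦ a²ᵐ` of cyclic subgroups of the vertex group. -/
noncomputable def doubling :
    (zpowersHom Base aBase).range ≃* (zpowersHom Base (aBase ^ (2 : ℤ))).range :=
  (MonoidHom.ofInjective zpowersHom_aBase_injective).symm.trans
    (MonoidHom.ofInjective zpowersHom_aBase_sq_injective)

/-- The HNN extension of `F₂ × F₂` with stable letter conjugating `a` to `a²`. -/
abbrev Ext : Type := HNNExtension Base _ _ doubling

/-- The canonical map from the free group to the HNN extension. -/
noncomputable def toExt : FreeGroup QGen →* Ext :=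
  FreeGroup.lift fun x => if x = b then HNNExtension.t⁻¹ else HNNExtension.of (toBaseGen x)

theorem toExt_a_zpow (m : ℤ) : toExt (.of a ^ m) = HNNExtension.of (aBase ^ m) := by
  have h : toExt (.of a) = HNNExtension.of aBase := by simp [toExt]
  rw [map_zpow toExt, h]
  exact (map_zpow HNNExtension.of aBase m).symm

theorem t_mul_of_aBase_zpow (m : ℤ) :
    HNNExtension.t * (HNNExtension.of (aBase ^ m) : Ext) =
      HNNExtension.of (aBase ^ (2 * m)) * HNNExtension.t := by
  have := HNNExtension.t_mul_of (φ := doubling)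
    (MonoidHom.ofInjective zpowersHom_aBase_injective (.ofAdd m))
  have e : (doubling (MonoidHom.ofInjective zpowersHom_aBase_injective (.ofAdd m)) : Base) =
      (aBase ^ (2 : ℤ)) ^ m := by
    rw [doubling, MulEquiv.trans_apply, MulEquiv.symm_apply_apply, MonoidHom.ofInjective_apply]
    rfl
  rw [e, MonoidHom.ofInjective_apply] at this
  rw [zpow_mul]
  exact this

theorem toExt_eq_one_of_nullHomotopic {w : Word QGen} (hw : NullHomotopic QRels w) :
    toExt (mk w) = 1 := by
  suffices h : Subgroup.normalClosure (mk '' QRels) ≤ toExt.ker from h hw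
  refine Subgroup.normalClosure_le_normal ?_
  rintro _ ⟨v, hv, rfl⟩
  have hb : HNNExtension.t * (HNNExtension.of aBase : Ext) =
      HNNExtension.of aBase * HNNExtension.of aBase * HNNExtension.t := by
    have := t_mul_of_aBase_zpow 1
    have e : (HNNExtension.of (aBase ^ (2 : ℤ)) : Ext) =
        HNNExtension.of aBase * HNNExtension.of aBase :=
      (congrArg _ (zpow_two aBase)).trans (map_mul HNNExtension.of aBase aBase)
    rwa [mul_one, zpow_one, e] at this
  simp only [QRels, Set.mem_insert_iff, Set.mem_singleton_iff] at hv
  rw [SetLike.mem_coe, MonoidHom.mem_ker]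
  rcases hv with rfl | rfl | rfl | rfl | rfl
  · simp only [toExt, FreeGroup.lift_mk, List.map_cons, List.map_nil, List.prod_cons,
      List.prod_nil, cond_true, cond_false]
    simp [← mul_assoc, hb]
  all_goals
    simp [toExt, FreeGroup.lift_mk, ← map_mul, ← map_inv, toBaseGen, ← Prod.one_eq_mk]

theorem toExt_mk_of_bFree {u : Word QGen} (hu : BFree u) :
    toExt (mk u) = HNNExtension.of (toBase (mk u)) := by
  induction u with
  | nil => rw [← FreeGroup.one_eq_mk]; simp
  | cons p u ih =>
    rw [mk_cons, map_mul, map_mul, map_mul, ih fun q hq => hu q (by simp [hq])]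
    congr 1
    have := hu p (by simp)
    obtain ⟨x, e⟩ := p
    cases e
    · rw [mk_false, map_inv, map_inv, map_inv]; simp_all [toExt, toBase]
    · rw [mk_true]; simp_all [toExt, toBase]

/-- The exponent with which the stable letter represents `b` or `b⁻¹`. -/
def stableExp (e : Bool) : ℤˣ := if e then -1 else 1

theorem toExt_b (e : Bool) :
    toExt (mk [(b, e)]) = HNNExtension.t ^ ((stableExp e : ℤˣ) : ℤ) := by
  cases e
  · rw [mk_false]; simp [toExt, stableExp]
  · rw [mk_true]; simp [toExt, stableExp]

/-- The word contains a subword `b^ε u b^{-ε}` which can be shortened in the HNN extension. -/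
def HasPinch (w : Word QGen) : Prop :=
  ∃ (p u q : Word QGen) (e : Bool), w = p ++ (b, e) :: (u ++ (b, !e) :: q) ∧ BFree u ∧
    toBase (mk u) ∈ HNNExtension.toSubgroup (zpowersHom Base aBase).range
      (zpowersHom Base (aBase ^ (2 : ℤ))).range (stableExp e)

theorem HasPinch.cons {w : Word QGen} (h : HasPinch w) (p : QGen × Bool) : HasPinch (p :: w) := by
  obtain ⟨p', u, q, e, rfl, hu⟩ := h
  exact ⟨p :: p', u, q, e, rfl, hu⟩

/-- A word without pinches is represented by a reduced word with the same `b`-structure. -/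
theorem hasPinch_or_exists_reducedWord (w : Word QGen) :
    HasPinch w ∨ ∃ (u v : Word QGen) (ρ : HNNExtension.NormalWord.ReducedWord Base
      (zpowersHom Base aBase).range (zpowersHom Base (aBase ^ (2 : ℤ))).range),
      w = u ++ v ∧ BFree u ∧ toBase (mk u) = ρ.head ∧ ρ.prod doubling = toExt (mk w) ∧
      ((v = [] ∧ ρ.toList = []) ∨ ∃ e q g l, v = (b, e) :: q ∧ ρ.toList = (stableExp e, g) :: l) := by
  induction w with
  | nil =>
    refine Or.inr ⟨[], [], .empty _ _ _, rfl, by simp [BFree], ?_, ?_, Or.inl ⟨rfl, rfl⟩⟩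
    · rw [← FreeGroup.one_eq_mk]; simp
    · rw [← FreeGroup.one_eq_mk]; simp [HNNExtension.NormalWord.ReducedWord.prod]
  | cons p w ih =>
    rcases ih with ih | ⟨u, v, ρ, rfl, hu, hhead, hprod, hv⟩
    · exact Or.inl (ih.cons p)
    by_cases hp : p.1 = b
    · obtain ⟨x, e⟩ := p
      obtain rfl : x = b := hp
      by_cases hpinch : HasPinch ((b, e) :: (u ++ v))
      · exact Or.inl hpinch
      refine Or.inr ⟨[], (b, e) :: (u ++ v), ⟨1, (stableExp e, ρ.head) :: ρ.toList, ?_⟩, rfl,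
        by simp [BFree], ?_, ?_, Or.inr ⟨e, u ++ v, ρ.head, ρ.toList, rfl, rfl⟩⟩
      · rcases hv with ⟨-, hl⟩ | ⟨e', q, g, l, rfl, hl⟩
        · simp [hl]
        · have hc := ρ.chain
          rw [hl] at hc ⊢
          refine List.isChain_cons_cons.2 ⟨fun hmem => ?_, hc⟩
          by_contra hne
          refine hpinch ⟨[], u, q, e, ?_, hu, hhead ▸ hmem⟩
          have : e' = !e := by
            cases e <;> cases e' <;> simp_all
          rw [this]; rfl
      · rw [← FreeGroup.one_eq_mk]; simp
      · rw [mk_cons, map_mul, ← hprod, toExt_b]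
        simp [HNNExtension.NormalWord.ReducedWord.prod, mul_assoc]
    · refine Or.inr ⟨p :: u, v, ⟨toBase (mk [p]) * ρ.head, ρ.toList, ρ.chain⟩, rfl, ?_, ?_, ?_, hv⟩
      · intro q hq
        rcases List.mem_cons.1 hq with rfl | hq
        exacts [hp, hu q hq]
      · rw [mk_cons, map_mul, hhead]
      · rw [mk_cons p (u ++ v), map_mul toExt, ← hprod, toExt_mk_of_bFree (u := [p]) (by simpa [BFree] using hp)]
        simp [HNNExtension.NormalWord.ReducedWord.prod, mul_assoc]

theorem hasPinch_or_bFree {w : Word QGen} (hw : toExt (mk w) = 1) : HasPinch w ∨ BFree w := by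
  rcases hasPinch_or_exists_reducedWord w with h | ⟨u, v, ρ, rfl, hu, -, hprod, hv⟩
  · exact Or.inl h
  refine Or.inr ?_
  have hl := HNNExtension.ReducedWord.toList_eq_nil_of_mem_of_range doubling ρ
    (by rw [hprod, hw]; exact one_mem _)
  rcases hv with ⟨rfl, -⟩ | ⟨e, q, g, l, -, h⟩
  · simpa using hu
  · simp [hl] at h

/-- The element `b⁻¹ aᵐ b` is `a²ᵐ` up to `|m|` relators. -/
theorem near_conj_zpow_a (m : ℤ) :
    Near QRels ((.of b)⁻¹ * .of a ^ m * .of b) (.of a ^ (2 * m)) m.natAbs := by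
  have := near_conj_a.zpow m
  have e : ((.of b)⁻¹ * .of a * .of b : FreeGroup QGen) ^ m =
      (.of b)⁻¹ * .of a ^ m * .of b := by
    simpa using conj_zpow (i := m) (a := (.of b)⁻¹) (b := (.of a : FreeGroup QGen))
  rwa [e, ← zpow_two, ← zpow_mul, mul_one] at this

/-- A pinch can be replaced by a power of `a` at quadratic cost. -/
theorem exists_near_of_pinch (u : Word QGen) (hu : BFree u) (e : Bool)
    (h : toBase (mk u) ∈ HNNExtension.toSubgroup (zpowersHom Base aBase).range
      (zpowersHom Base (aBase ^ (2 : ℤ))).range (stableExp e)) :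
    ∃ k : ℤ, k.natAbs ≤ 2 * u.length ∧
      Near QRels (mk [(b, e)] * mk u * mk [(b, !e)]) (.of a ^ k) (5 * (u.length + 1) ^ 2) ∧
      toExt (mk [(b, e)] * mk u * mk [(b, !e)]) = toExt (.of a ^ k) := by
  cases e
  · obtain ⟨m, hm⟩ : ∃ m : ℤ, toBase (mk u) = aBase ^ m := by
      obtain ⟨m, hm⟩ := h
      exact ⟨m.toAdd, hm.symm⟩
    have hle := natAbs_le_length hm
    refine ⟨2 * m, by omega, ?_, ?_⟩
    · have h1 := ((near_zpow_a u hu m hm).mul_left (.of b)⁻¹).mul_right (.of b)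
      have hsq := Nat.pow_le_pow_left (Nat.add_le_add_left hle u.length) 2
      exact (h1.trans (near_conj_zpow_a m)).mono (by nlinarith)
    · rw [map_mul, map_mul, toExt_mk_of_bFree hu, hm, toExt_b, toExt_b]
      have h2 : (HNNExtension.of (aBase ^ (2 * m)) : Ext) =
          HNNExtension.t * HNNExtension.of (aBase ^ m) * HNNExtension.t⁻¹ := by
        rw [t_mul_of_aBase_zpow, mul_inv_cancel_right]
      rw [toExt_a_zpow, h2]
      simp [stableExp]
  · obtain ⟨m, hm⟩ : ∃ m : ℤ, toBase (mk u) = aBase ^ (2 * m) := by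
      obtain ⟨m, hm⟩ := h
      exact ⟨m.toAdd, by rw [← hm, zpowersHom_apply, zpow_mul]⟩
    have hle := natAbs_le_length hm
    refine ⟨m, by omega, ?_, ?_⟩
    · have h1 := ((near_zpow_a u hu _ hm).mul_left (.of b)).mul_right (.of b)⁻¹
      have h2 := (((near_conj_zpow_a m).symm.mul_left (.of b)).mul_right (.of b)⁻¹)
      have h3 := (h1.trans h2).trans (Near.of_eq (h := .of a ^ m) (by group))
      exact h3.mono (by
        have : m.natAbs ≤ u.length := by omega
        have hsq := Nat.pow_le_pow_left (Nat.add_le_add_left hle u.length) 2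
        nlinarith)
    · rw [map_mul, map_mul, toExt_mk_of_bFree hu, hm, toExt_b, toExt_b]
      have h2 : (HNNExtension.of (aBase ^ m) : Ext) =
          HNNExtension.t⁻¹ * HNNExtension.of (aBase ^ (2 * m)) * HNNExtension.t := by
        rw [mul_assoc, ← t_mul_of_aBase_zpow, inv_mul_cancel_left]
      rw [toExt_a_zpow, h2]
      simp [stableExp]

theorem area_le_of_toExt_eq_one (N : ℕ) (w : Word QGen) (hN : countLtr b w ≤ N)
    (hw : toExt (mk w) = 1) : AreaLe QRels (mk w) (4 ^ N * w.length ^ 2) := by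
  induction N using Nat.strong_induction_on generalizing w with
  | _ N ih =>
  rcases hasPinch_or_bFree hw with ⟨p, u, q, e, rfl, hu, hmem⟩ | hfree
  · obtain ⟨k, hk, hnear, hext⟩ := exists_near_of_pinch u hu e hmem
    have hsplit : mk (p ++ (b, e) :: (u ++ (b, !e) :: q)) =
        mk p * (mk [(b, e)] * mk u * mk [(b, !e)]) * mk q := by
      simp [FreeGroup.mul_mk]
    have hsplit' : mk (p ++ (aWord k ++ q)) = mk p * .of a ^ k * mk q := by
      rw [← mk_aWord]; simp [FreeGroup.mul_mk]
    have hcount : countLtr b (p ++ (aWord k ++ q)) + 2 ≤ N := by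
      refine le_trans ?_ hN
      simp [countLtr, aWord]
      omega
    obtain ⟨M, rfl⟩ := Nat.exists_eq_add_of_le' (le_of_add_le_right hcount)
    have harea := ih M (by omega) (p ++ (aWord k ++ q)) (by omega) (by
      rw [hsplit', map_mul, map_mul, ← hext, ← map_mul, ← map_mul, ← hsplit, hw])
    have h1 := (hnear.mul_left (mk p)).mul_right (mk q)
    rw [← hsplit, ← hsplit'] at h1
    have h2 := AreaLe.mul h1 harea
    rw [inv_mul_cancel_right] at h2
    refine h2.mono ?_
    simp only [List.length_append, List.length_cons, length_aWord]
    set L := p.length + (u.length + (q.length + 1) + 1) with hL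
    have hle : p.length + (k.natAbs + q.length) ≤ 2 * L := by omega
    have hle' : u.length + 1 ≤ L := by omega
    have hsq := Nat.pow_le_pow_left hle 2
    have hsq' := Nat.pow_le_pow_left hle' 2
    have hpos : 1 ≤ 4 ^ M := Nat.one_le_pow _ _ (by norm_num)
    have h3 := Nat.mul_le_mul_left (4 ^ M) hsq
    have h4 := Nat.mul_le_mul_right (L ^ 2) hpos
    rw [pow_add]
    nlinarith
  · have hbase : toBase (mk w) = 1 := by
      rw [toExt_mk_of_bFree hfree] at hw
      exact (map_eq_one_iff _ (HNNExtension.of_injective doubling)).1 hw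
    exact (area_le_of_toBase_eq_one w hfree hbase).mono
      (Nat.le_mul_of_pos_left _ (by positivity))

end QGen

theorem area_exponential_upper_bound :
    ∃ C : ℕ, 1 < C ∧ ∀ w : Word QGen, NullHomotopic QRels w →
      AreaLe QRels (FreeGroup.mk w) (C ^ w.length) := by
  refine ⟨16, by norm_num, fun w hw => ?_⟩
  refine (QGen.area_le_of_toExt_eq_one w.length w (List.length_filter_le _ _)
    (QGen.toExt_eq_one_of_nullHomotopic hw)).mono ?_
  calc 4 ^ w.length * w.length ^ 2 ≤ 4 ^ w.length * (2 ^ w.length) ^ 2 := by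
        gcongr; exact Nat.lt_two_pow_self.le
    _ = 16 ^ w.length := by
        rw [← pow_mul, mul_comm w.length 2, pow_mul, ← mul_pow]; norm_num
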